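/- For the hyperoctahedral group C_n (signed permutations on n letters, of order 2^n · n!), the number of Boolean intervals of rank k in the right weak order equals 2^{n-k} · n! · binomial(n+1-k, k). -/

import Mathlib

/-- The right weak order on a Coxeter group: `u ≤ w` iff `ℓ(u) + ℓ(u⁻¹w) = ℓ(w)`. -/
def weakLE {B W : Type*} [Group W] {M : CoxeterMatrix B} (cs : CoxeterSystem M W)
    (u w : W) : Prop :=
  cs.length u + cs.length (u⁻¹ * w) = cs.length w

/-- The interval `[v, w]` in the right weak order is Boolean of rank `k`: it is order
isomorphic to the lattice of subsets of a `k`-element set, ordered by inclusion. -/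
def IsBooleanInterval {B W : Type*} [Group W] {M : CoxeterMatrix B} (cs : CoxeterSystem M W)
    (k : ℕ) (v w : W) : Prop :=
  weakLE cs v w ∧
    ∃ f : {x : W // weakLE cs v x ∧ weakLE cs x w} ≃ Finset (Fin k),
      ∀ a b, weakLE cs a.1 b.1 ↔ f a ⊆ f b


namespace BoolInt

open CoxeterSystem

section generic

set_option linter.unusedSectionVars false

variable {B W : Type*} [Group W] {M : CoxeterMatrix B} (cs : CoxeterSystem M W)

/-- The (right) exchange property. -/
def Exch : Prop := ∀ (ω : List B) (i : B), cs.IsRightDescent (cs.wordProd ω) i →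
  ∃ j, j < ω.length ∧ cs.wordProd ω * cs.simple i = cs.wordProd (ω.eraseIdx j)

/-- A set of pairwise commuting simple reflections. -/
def Comm (J : Finset B) : Prop :=
  ∀ i ∈ J, ∀ j ∈ J, cs.simple i * cs.simple j = cs.simple j * cs.simple i

/-- Product of the simple reflections in a finset. -/
noncomputable def sP (A : Finset B) : W := cs.wordProd A.toList

variable {cs}

theorem Comm.mono {A J : Finset B} (h : Comm cs J) (hA : A ⊆ J) : Comm cs A :=
  fun i hi j hj => h i (hA hi) j (hA hj)

theorem wordProd_perm {J : Finset B} (hJ : Comm cs J) {ω ω' : List B} (h : ω.Perm ω')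
    (hω : ∀ i ∈ ω, i ∈ J) : cs.wordProd ω = cs.wordProd ω' := by
  unfold wordProd
  refine (h.map _).prod_eq' ?_
  rw [List.pairwise_map]
  refine List.Pairwise.imp_of_mem (R := fun _ _ => True) ?_ (by simp [List.pairwise_iff_getElem])
  intro a b ha hb _
  exact hJ a (hω a ha) b (hω b hb)

theorem sP_empty : sP cs ∅ = 1 := by simp [sP]

variable [DecidableEq B]

theorem sP_insert {A : Finset B} {i : B} (h : Comm cs (insert i A)) (hi : i ∉ A) :
    sP cs (insert i A) = sP cs A * cs.simple i := by
  have : sP cs (insert i A) = cs.wordProd (A.toList ++ [i]) := by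
    refine wordProd_perm h ((Finset.toList_insert hi).trans ?_) (by simp)
    exact (List.perm_append_singleton i A.toList).symm
  rw [this, wordProd_append, wordProd_singleton]; rfl

theorem sP_erase {A : Finset B} {i : B} (h : Comm cs A) (hi : i ∈ A) :
    sP cs A = sP cs (A.erase i) * cs.simple i := by
  conv_lhs => rw [← Finset.insert_erase hi]
  exact sP_insert (by rwa [Finset.insert_erase hi]) (by simp)

theorem exch_sP (hE : Exch cs) {A : Finset B} (h : Comm cs A) {b : B}
    (hb : cs.IsRightDescent (sP cs A) b) : ∃ c ∈ A, sP cs A * cs.simple b = sP cs (A.erase c) := by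
  obtain ⟨j, hj, e⟩ := hE _ _ hb
  refine ⟨A.toList[j], Finset.mem_toList.1 (List.getElem_mem hj), ?_⟩
  have key : (A.toList.eraseIdx j).Perm (A.erase A.toList[j]).toList := by
    rw [List.perm_ext_iff_of_nodup ((Finset.nodup_toList A).eraseIdx j) (Finset.nodup_toList _)]
    intro x
    rw [← (Finset.nodup_toList A).erase_getElem j hj, (Finset.nodup_toList A).mem_erase_iff]
    simp
  unfold sP
  rw [e]
  exact wordProd_perm h key (fun i hi => by simpa using List.mem_of_mem_eraseIdx hi)

theorem desc_comm_aux (hE : Exch cs) (hinj : Function.Injective cs.simple) {w : W} {i j : B}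
    (hij : i ≠ j) (hc : cs.simple i * cs.simple j = cs.simple j * cs.simple i)
    (h : ¬ cs.IsRightDescent w j) : ¬ cs.IsRightDescent (w * cs.simple i) j := by
  by_cases hi : cs.IsRightDescent w i
  · rw [cs.isRightDescent_iff] at hi
    rw [cs.not_isRightDescent_iff] at h
    unfold IsRightDescent
    have h1 := cs.length_mul_simple (w * cs.simple j) i
    rw [mul_assoc, hc, ← mul_assoc] at *
    rw [mul_assoc w, hc, ← mul_assoc] at h1
    omega
  · intro hd
    obtain ⟨ω, hω, rfl⟩ := cs.exists_isReduced w
    rw [← wordProd_singleton, ← wordProd_append] at hd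
    obtain ⟨k, hk, e⟩ := hE _ _ hd
    by_cases hk' : k < ω.length
    · rw [List.eraseIdx_append_of_lt_length hk', wordProd_append, wordProd_append,
        wordProd_singleton, mul_assoc, hc, ← mul_assoc, mul_left_inj] at e
      rw [cs.not_isRightDescent_iff, e] at h
      have := cs.length_wordProd_le (ω.eraseIdx k)
      rw [List.length_eraseIdx_of_lt hk'] at this
      have := hω.eq
      omega
    · have : k = ω.length := by simp at hk; omega
      subst this
      rw [List.eraseIdx_append_of_length_le le_rfl] at e
      simp [wordProd_append, mul_assoc] at e
      apply hij; apply hinj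
      rw [← cs.inv_simple j]
      exact eq_inv_of_mul_eq_one_left e

theorem desc_comm (hE : Exch cs) (hinj : Function.Injective cs.simple) {w : W} {i j : B}
    (hij : i ≠ j) (hc : cs.simple i * cs.simple j = cs.simple j * cs.simple i) :
    cs.IsRightDescent (w * cs.simple i) j ↔ cs.IsRightDescent w j := by
  constructor
  · intro h; by_contra h'; exact desc_comm_aux hE hinj hij hc h' h
  · intro h; by_contra h'
    have := desc_comm_aux hE hinj hij hc h'
    simp at this
    exact this h

theorem desc_sP (hE : Exch cs) (hinj : Function.Injective cs.simple) {J : Finset B}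
    (hJ : Comm cs J) (w : W) {j : B} (hj : j ∈ J) (A : Finset B) (hA : A ⊆ J) :
    cs.IsRightDescent (w * sP cs A) j ↔ ¬ (cs.IsRightDescent w j ↔ j ∈ A) := by
  induction A using Finset.induction_on with
  | empty => simp [sP_empty]
  | insert i A hi ih =>
    have hA' : A ⊆ J := fun x hx => hA (Finset.mem_insert_of_mem hx)
    rw [sP_insert (hJ.mono hA) hi, ← mul_assoc]
    by_cases hij : i = j
    · subst hij
      rw [cs.isRightDescent_iff_not_isRightDescent_mul]
      simp only [cs.simple_mul_simple_cancel_right, ih hA']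
      simp [hi]
    · rw [desc_comm hE hinj hij (hJ i (hA (by simp)) j hj), ih hA']
      simp [Ne.symm hij]

theorem length_sP (hE : Exch cs) (hinj : Function.Injective cs.simple) {J : Finset B}
    (hJ : Comm cs J) (v : W) (hv : ∀ j ∈ J, ¬ cs.IsRightDescent v j) (A : Finset B) (hA : A ⊆ J) :
    cs.length (v * sP cs A) = cs.length v + A.card := by
  induction A using Finset.induction_on with
  | empty => simp [sP_empty]
  | insert i A hi ih =>
    have hA' : A ⊆ J := fun x hx => hA (Finset.mem_insert_of_mem hx)
    have hiJ : i ∈ J := hA (by simp)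
    rw [sP_insert (hJ.mono hA) hi, ← mul_assoc, Finset.card_insert_of_notMem hi]
    have : ¬ cs.IsRightDescent (v * sP cs A) i := by
      rw [desc_sP hE hinj hJ v hiJ A hA']
      simp [hv i hiJ, hi]
    rw [cs.not_isRightDescent_iff.1 this, ih hA']; ring

theorem length_sP' (hE : Exch cs) (hinj : Function.Injective cs.simple) {J : Finset B}
    (hJ : Comm cs J) : cs.length (sP cs J) = J.card := by
  simpa using length_sP hE hinj hJ 1 (fun j _ => cs.not_isRightDescent_one j) J (le_refl _)

theorem sub_sP (hE : Exch cs) (hinj : Function.Injective cs.simple) (n : ℕ) :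
    ∀ (A : Finset B) (z : W), Comm cs A → cs.length z = n →
    cs.length (sP cs A * z) + cs.length z = A.card → ∃ C, C ⊆ A ∧ sP cs A * z = sP cs C := by
  induction n with
  | zero =>
    intro A z hA hz _
    rw [cs.length_eq_zero_iff] at hz
    exact ⟨A, le_refl _, by simp [hz]⟩
  | succ n ih =>
    intro A z hA hz h
    have hz1 : z ≠ 1 := by rintro rfl; simp at hz
    obtain ⟨b, hb⟩ := cs.exists_leftDescent_of_ne_one hz1
    rw [cs.isLeftDescent_iff] at hb
    obtain ⟨z', rfl⟩ : ∃ z', z = cs.simple b * z' := ⟨cs.simple b * z, by simp⟩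
    simp only [cs.simple_mul_simple_cancel_left] at hb
    have hl := length_sP' hE hinj hA
    have hd : cs.IsRightDescent (sP cs A) b := by
      unfold IsRightDescent
      have := cs.length_le_length_mul_add_right (sP cs A * cs.simple b) z'
      rw [mul_assoc] at this
      omega
    obtain ⟨c, hc, e⟩ := exch_sP hE hA hd
    rw [← mul_assoc, e] at h ⊢
    have hcard := Finset.card_erase_add_one hc
    obtain ⟨C, hC, e'⟩ := ih (A.erase c) z' (hA.mono (Finset.erase_subset _ _)) (by omega) (by omega)
    exact ⟨C, hC.trans (Finset.erase_subset _ _), e'⟩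

theorem sP_sub_of_eq (hE : Exch cs) (hinj : Function.Injective cs.simple) {A A' : Finset B}
    (hA : Comm cs A) (hA' : Comm cs A') (h : sP cs A = sP cs A') : A ⊆ A' := by
  intro i hi
  have hd : cs.IsRightDescent (sP cs A) i := by
    have := desc_sP hE hinj hA 1 hi A (le_refl _)
    simpa [hi, cs.not_isRightDescent_one] using this
  rw [h] at hd
  obtain ⟨c, hc, e⟩ := exch_sP hE hA' hd
  rw [sP_erase hA' hc, mul_assoc, mul_eq_left] at e
  have : c = i := by
    apply hinj
    rw [← cs.inv_simple i]
    exact eq_inv_of_mul_eq_one_left e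
  exact this ▸ hc

theorem sP_inj (hE : Exch cs) (hinj : Function.Injective cs.simple) {A A' : Finset B}
    (hA : Comm cs A) (hA' : Comm cs A') (h : sP cs A = sP cs A') : A = A' :=
  Finset.Subset.antisymm (sP_sub_of_eq hE hinj hA hA' h) (sP_sub_of_eq hE hinj hA' hA h.symm)

theorem sP_union {A C : Finset B} (h : Comm cs (A ∪ C)) (hd : Disjoint A C) :
    sP cs (A ∪ C) = sP cs A * sP cs C := by
  induction C using Finset.induction_on with
  | empty => simp [sP_empty]
  | insert i C hi ih =>
    have hsub : A ∪ C ⊆ A ∪ insert i C :=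
      Finset.union_subset_union (le_refl _) (Finset.subset_insert _ _)
    rw [Finset.disjoint_insert_right] at hd
    rw [sP_insert (h.mono Finset.subset_union_right) hi, ← mul_assoc, ← ih (h.mono hsub) hd.2]
    rw [Finset.union_insert] at h ⊢
    exact sP_insert h (by simp [hd.1, hi])

theorem weakLE_sP (hE : Exch cs) (hinj : Function.Injective cs.simple) {J : Finset B}
    (hJ : Comm cs J) (v : W) (hv : ∀ j ∈ J, ¬ cs.IsRightDescent v j) {A C : Finset B}
    (hA : A ⊆ J) (hC : C ⊆ J) : weakLE cs (v * sP cs A) (v * sP cs C) ↔ A ⊆ C := by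
  unfold weakLE
  rw [length_sP hE hinj hJ v hv A hA, length_sP hE hinj hJ v hv C hC]
  have e : (v * sP cs A)⁻¹ * (v * sP cs C) = (sP cs A)⁻¹ * sP cs C := by group
  rw [e]
  constructor
  · intro h
    have e2 : sP cs C * ((sP cs A)⁻¹ * sP cs C)⁻¹ = sP cs A := by group
    obtain ⟨D, hD, e3⟩ := sub_sP hE hinj _ C ((sP cs A)⁻¹ * sP cs C)⁻¹ (hJ.mono hC) rfl (by
      rw [e2, length_sP' hE hinj (hJ.mono hA), cs.length_inv]; omega)
    rw [e2] at e3
    rw [sP_inj hE hinj (hJ.mono hA) (hJ.mono (hD.trans hC)) e3]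
    exact hD
  · intro h
    have e4 := sP_union (cs := cs) (A := A) (C := C \ A)
      (by rw [Finset.union_sdiff_of_subset h]; exact hJ.mono hC) Finset.disjoint_sdiff
    rw [Finset.union_sdiff_of_subset h] at e4
    rw [e4, inv_mul_cancel_left,
      length_sP' hE hinj (hJ.mono (Finset.sdiff_subset.trans hC))]
    have := Finset.card_sdiff_add_card_eq_card h
    omega

theorem between_sP (hE : Exch cs) (hinj : Function.Injective cs.simple) {J : Finset B}
    (hJ : Comm cs J) (v : W) (hv : ∀ j ∈ J, ¬ cs.IsRightDescent v j) {x : W}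
    (h1 : weakLE cs v x) (h2 : weakLE cs x (v * sP cs J)) : ∃ A, A ⊆ J ∧ x = v * sP cs A := by
  unfold weakLE at h1 h2
  rw [length_sP hE hinj hJ v hv J (le_refl _)] at h2
  have e2 : sP cs J * (x⁻¹ * (v * sP cs J))⁻¹ = v⁻¹ * x := by group
  obtain ⟨D, hD, e3⟩ := sub_sP hE hinj _ J (x⁻¹ * (v * sP cs J))⁻¹ hJ rfl (by
    rw [e2, cs.length_inv]; omega)
  rw [e2] at e3
  exact ⟨D, hD, by rw [← e3]; group⟩

theorem isBoolean_sP (hE : Exch cs) (hinj : Function.Injective cs.simple) {J : Finset B}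
    (hJ : Comm cs J) (v : W) (hv : ∀ j ∈ J, ¬ cs.IsRightDescent v j) :
    IsBooleanInterval cs J.card v (v * sP cs J) := by
  have hvE : v = v * sP cs ∅ := by simp [sP_empty]
  have hbot : ∀ A ⊆ J, weakLE cs v (v * sP cs A) := by
    intro A hA
    have := (weakLE_sP hE hinj hJ v hv (A := ∅) (by simp) hA).2 (by simp)
    rwa [← hvE] at this
  refine ⟨hbot J (le_refl _), ?_⟩
  let e := J.equivFin.symm
  let em : Fin J.card ↪ B := e.toEmbedding.trans (Function.Embedding.subtype _)
  have hem : ∀ A : Finset (Fin J.card), A.map em ⊆ J := by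
    intro A x hx
    simp only [Finset.mem_map] at hx
    obtain ⟨a, _, rfl⟩ := hx
    exact (e a).2
  let g : Finset (Fin J.card) → {x : W // weakLE cs v x ∧ weakLE cs x (v * sP cs J)} :=
    fun A => ⟨v * sP cs (A.map em), hbot _ (hem A),
      (weakLE_sP hE hinj hJ v hv (hem A) (le_refl _)).2 (hem A)⟩
  have hg : Function.Bijective g := by
    constructor
    · intro A C h
      have h' : v * sP cs (A.map em) = v * sP cs (C.map em) := congrArg Subtype.val h
      rw [mul_right_inj] at h'
      exact Finset.map_injective em (sP_inj hE hinj (hJ.mono (hem A)) (hJ.mono (hem C)) h')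
    · rintro ⟨x, h1, h2⟩
      obtain ⟨A, hA, rfl⟩ := between_sP hE hinj hJ v hv h1 h2
      refine ⟨Finset.univ.filter (fun a => em a ∈ A), Subtype.ext ?_⟩
      have : (Finset.univ.filter (fun a => em a ∈ A)).map em = A := by
        ext b
        simp only [Finset.mem_map, Finset.mem_filter, Finset.mem_univ, true_and]
        constructor
        · rintro ⟨a, ha, rfl⟩; exact ha
        · intro hb
          have : em (e.symm ⟨b, hA hb⟩) = b := by simp [em]
          exact ⟨e.symm ⟨b, hA hb⟩, by rwa [this], this⟩
      simp only [g, this]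
  refine ⟨(Equiv.ofBijective g hg).symm, ?_⟩
  intro a b
  obtain ⟨A, rfl⟩ := hg.2 a
  obtain ⟨C, rfl⟩ := hg.2 b
  have h3 : ∀ A, (Equiv.ofBijective g hg).symm (g A) = A :=
    fun A => (Equiv.ofBijective g hg).symm_apply_apply A
  rw [h3, h3]
  simp only [g]
  rw [weakLE_sP hE hinj hJ v hv (hem A) (hem C), Finset.map_subset_map]


theorem weakLE_trans {x y z : W} (h1 : weakLE cs x y) (h2 : weakLE cs y z) : weakLE cs x z := by
  unfold weakLE at *
  have a := cs.length_mul_le (x⁻¹ * y) (y⁻¹ * z)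
  have b := cs.length_mul_le x (x⁻¹ * z)
  rw [mul_assoc, mul_inv_cancel_left] at a
  rw [mul_inv_cancel_left] at b
  omega

theorem weakLE_refl (x : W) : weakLE cs x x := by simp [weakLE]

theorem len2 (hE : Exch cs) (hinj : Function.Injective cs.simple) {i a j c : B} (hij : i ≠ j)
    (h : cs.simple i * cs.simple a = cs.simple j * cs.simple c)
    (hl : 2 ≤ cs.length (cs.simple i * cs.simple a)) : a = j := by
  have e0 : cs.wordProd [i, a] = cs.simple i * cs.simple a := by simp [wordProd]
  have hd : cs.IsRightDescent (cs.wordProd [i, a]) c := by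
    unfold IsRightDescent
    rw [e0]
    refine lt_of_lt_of_le ?_ hl
    rw [h]; simp
  obtain ⟨k, hk, e⟩ := hE _ _ hd
  rw [e0, h, cs.simple_mul_simple_cancel_right] at e
  simp at hk
  interval_cases k
  · simp at e; exact (hinj e).symm
  · simp at e; exact absurd (hinj e).symm hij

theorem exists_of_isBoolean (hE : Exch cs) (hinj : Function.Injective cs.simple) {k : ℕ} {v w : W}
    (h : IsBooleanInterval cs k v w) : ∃ J : Finset B, Comm cs J ∧ J.card = k ∧
      (∀ j ∈ J, ¬ cs.IsRightDescent v j) ∧ w = v * sP cs J := by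
  obtain ⟨hvw, f, hf⟩ := h
  let F : Finset (Fin k) → W := fun A => (f.symm A).1
  have hFle : ∀ A C, weakLE cs (F A) (F C) ↔ A ⊆ C := by
    intro A C
    simp only [F]
    rw [hf]; simp
  have hFinj : Function.Injective F := fun A C h => f.symm.injective (Subtype.ext h)
  have hFsurj : ∀ x, weakLE cs v x → weakLE cs x w → ∃ A, F A = x := fun x h1 h2 =>
    ⟨f ⟨x, h1, h2⟩, by simp [F]⟩
  have hF1 : ∀ A, weakLE cs v (F A) := fun A => (f.symm A).2.1
  have hF2 : ∀ A, weakLE cs (F A) w := fun A => (f.symm A).2.2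
  have hbot : F ∅ = v := by
    obtain ⟨A, hA⟩ := hFsurj v (weakLE_refl v) hvw
    have := hF1 ∅
    rw [← hA, hFle, Finset.subset_empty] at this
    rw [← this, hA]
  have htop : F Finset.univ = w := by
    obtain ⟨A, hA⟩ := hFsurj w hvw (weakLE_refl w)
    have := hF2 Finset.univ
    rw [← hA, hFle, Finset.univ_subset_iff] at this
    rw [← this, hA]
  have hcov : ∀ (A : Finset (Fin k)) (i : Fin k), i ∉ A → ∃ b, F (insert i A) = F A * cs.simple b ∧
      cs.length (F A * cs.simple b) = cs.length (F A) + 1 := by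
    intro A i hi
    have hle : weakLE cs (F A) (F (insert i A)) := (hFle _ _).2 (Finset.subset_insert _ _)
    have hne : (F A)⁻¹ * F (insert i A) ≠ 1 := by
      intro h
      rw [inv_mul_eq_one] at h
      have := hFinj h
      rw [this] at hi
      simp at hi
    obtain ⟨b, hb⟩ := cs.exists_leftDescent_of_ne_one hne
    rw [cs.isLeftDescent_iff] at hb
    have hle' := hle
    unfold weakLE at hle'
    have hyx : F A * cs.simple b * (cs.simple b * ((F A)⁻¹ * F (insert i A))) = F (insert i A) := by
      rw [mul_assoc, cs.simple_mul_simple_cancel_left]; group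
    have hy : (F A * cs.simple b)⁻¹ * F (insert i A)
        = cs.simple b * ((F A)⁻¹ * F (insert i A)) := by
      rw [mul_inv_rev, cs.inv_simple, mul_assoc]
    have h1 := cs.length_mul_le (F A * cs.simple b) (cs.simple b * ((F A)⁻¹ * F (insert i A)))
    rw [hyx] at h1
    have h2 := cs.length_mul_simple (F A) b
    have l1 : weakLE cs (F A) (F A * cs.simple b) := by
      unfold weakLE; rw [inv_mul_cancel_left, cs.length_simple]; omega
    have l2 : weakLE cs (F A * cs.simple b) (F (insert i A)) := by
      unfold weakLE; rw [hy]; omega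
    obtain ⟨C, hC⟩ := hFsurj _ (weakLE_trans (hF1 A) l1) (weakLE_trans l2 (hF2 _))
    rw [← hC, hFle] at l1 l2
    have hCA : C ≠ A := by
      rintro rfl
      have := cs.length_mul_simple_ne (F C) b
      rw [← hC] at this
      exact this rfl
    have hCi : C = insert i A := by
      apply Finset.Subset.antisymm l2
      by_contra hcon
      apply hCA
      apply Finset.Subset.antisymm _ l1
      intro x hx
      have := l2 hx
      rw [Finset.mem_insert] at this
      rcases this with rfl | h
      · exact absurd (Finset.insert_subset hx l1) hcon
      · exact h
    refine ⟨b, by rw [← hC, hCi], by omega⟩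
  have hcov0 : ∀ i : Fin k, ∃ b, F {i} = v * cs.simple b ∧
      cs.length (v * cs.simple b) = cs.length v + 1 := by
    intro i
    have := hcov ∅ i (by simp)
    rwa [hbot] at this
  choose b hb hbl using hcov0
  have hbinj : Function.Injective b := by
    intro i j hij
    have : F {i} = F {j} := by rw [hb, hb, hij]
    simpa using hFinj this
  have hstep : ∀ A : Finset (Fin k), ∀ i, i ∉ A → F (insert i A) = F A * cs.simple (b i) := by
    intro A
    induction A using Finset.induction_on with
    | empty => intro i _; rw [hbot]; exact hb i
    | insert j A hj ih =>
      intro i hi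
      simp only [Finset.mem_insert, not_or] at hi
      obtain ⟨a, ha, hla⟩ := hcov (insert j A) i (by simp [hi])
      obtain ⟨c, hc, hlc⟩ := hcov (insert i A) j (by simp [Ne.symm hi.1, hj])
      obtain ⟨d, hd, hld⟩ := hcov A j hj
      rw [← hd] at hld
      have e : F (insert i (insert j A)) = F (insert j (insert i A)) := by
        rw [Finset.insert_comm]
      rw [ha, hc, ih j hj, ih i hi.2, mul_assoc, mul_assoc, mul_right_inj] at e
      have hl : 2 ≤ cs.length (cs.simple (b j) * cs.simple a) := by
        have := cs.length_mul_le (F A) (cs.simple (b j) * cs.simple a)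
        rw [← mul_assoc, ← ih j hj, hla] at this
        omega
      have := len2 hE hinj (fun h => hi.1 (hbinj h).symm) e hl
      rw [ha, this]
  have hcomm : Comm cs (Finset.univ.image b) := by
    intro x hx y hy
    simp only [Finset.mem_image, Finset.mem_univ, true_and] at hx hy
    obtain ⟨i, rfl⟩ := hx
    obtain ⟨j, rfl⟩ := hy
    by_cases hij : i = j
    · rw [hij]
    · have e1 := hstep {i} j (by simpa using Ne.symm hij)
      have e2 := hstep {j} i (by simpa using hij)
      have e3 : (insert j {i} : Finset (Fin k)) = insert i {j} := Finset.pair_comm _ _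
      rw [e3, e2, hb, hb, mul_assoc, mul_assoc, mul_right_inj] at e1
      exact e1.symm
  have hprod : ∀ A : Finset (Fin k), F A = v * sP cs (A.image b) := by
    intro A
    induction A using Finset.induction_on with
    | empty => simp [sP_empty, hbot]
    | insert j A hj ih =>
      rw [hstep A j hj, ih, Finset.image_insert, mul_assoc, sP_insert]
      · rw [← Finset.image_insert]
        exact hcomm.mono (Finset.image_subset_image (Finset.subset_univ _))
      · simpa [hbinj.eq_iff] using hj
  refine ⟨Finset.univ.image b, hcomm, ?_, ?_, ?_⟩
  · rw [Finset.card_image_of_injective _ hbinj]; simp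
  · intro x hx
    simp only [Finset.mem_image, Finset.mem_univ, true_and] at hx
    obtain ⟨i, rfl⟩ := hx
    rw [cs.not_isRightDescent_iff]
    exact hbl i
  · rw [← hprod, htop]

theorem card_min (hE : Exch cs) (hinj : Function.Injective cs.simple) {J : Finset B}
    (hJ : Comm cs J) : Nat.card {v : W // ∀ j ∈ J, ¬ cs.IsRightDescent v j} * 2 ^ J.card =
      Nat.card W := by
  classical
  have h2 : Nat.card {A // A ∈ J.powerset} = 2 ^ J.card := by
    rw [Nat.card_eq_fintype_card, Fintype.card_coe, Finset.card_powerset]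
  rw [← h2, ← Nat.card_prod]
  let g : {v : W // ∀ j ∈ J, ¬ cs.IsRightDescent v j} × {A // A ∈ J.powerset} → W :=
    fun p => p.1.1 * sP cs p.2.1
  refine Nat.card_congr (Equiv.ofBijective g ⟨?_, ?_⟩)
  · rintro ⟨⟨v, hv⟩, ⟨A, hA⟩⟩ ⟨⟨v', hv'⟩, ⟨A', hA'⟩⟩ h
    simp only [g] at h
    rw [Finset.mem_powerset] at hA hA'
    have hAA : A = A' := by
      ext j
      by_cases hj : j ∈ J
      · have a := desc_sP hE hinj hJ v hj A hA
        have b := desc_sP hE hinj hJ v' hj A' hA'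
        rw [h, b] at a
        simp [hv j hj, hv' j hj] at a
        tauto
      · exact ⟨fun h => absurd (hA h) hj, fun h => absurd (hA' h) hj⟩
    subst hAA
    rw [mul_left_inj] at h
    subst h
    rfl
  · intro w
    let A := J.filter (fun j => cs.IsRightDescent w j)
    have hA : A ⊆ J := Finset.filter_subset _ _
    have hinv : sP cs A * sP cs A = 1 := by
      have : ∀ C, C ⊆ J → sP cs C * sP cs C = 1 := by
        intro C
        induction C using Finset.induction_on with
        | empty => simp [sP_empty]
        | insert i C hi ih =>
          intro hC
          have hc : ∀ D, D ⊆ J → cs.simple i * sP cs D = sP cs D * cs.simple i := by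
            intro D
            induction D using Finset.induction_on with
            | empty => simp [sP_empty]
            | insert l D hl ih2 =>
              intro hD
              rw [sP_insert (hJ.mono hD) hl, ← mul_assoc,
                ih2 ((Finset.subset_insert _ _).trans hD), mul_assoc, mul_assoc,
                hJ i (hC (by simp)) l (hD (by simp))]
          rw [sP_insert (hJ.mono hC) hi, mul_assoc, ← mul_assoc (cs.simple i),
            hc C ((Finset.subset_insert _ _).trans hC), mul_assoc, cs.simple_mul_simple_self,
            mul_one]
          exact ih ((Finset.subset_insert _ _).trans hC)
      exact this A hA
    refine ⟨⟨⟨w * sP cs A, ?_⟩, ⟨A, Finset.mem_powerset.2 hA⟩⟩, ?_⟩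
    · intro j hj
      rw [desc_sP hE hinj hJ w hj A hA]
      simp [A, hj]
    · simp only [g]
      rw [mul_assoc, hinv, mul_one]

theorem card_generic [Fintype B] [Finite W] (hE : Exch cs) (hinj : Function.Injective cs.simple) (k : ℕ) :
    Nat.card {p : W × W // IsBooleanInterval cs k p.1 p.2} * 2 ^ k =
      Nat.card {J : Finset B // Comm cs J ∧ J.card = k} * Nat.card W := by
  classical
  let g : (Σ J : {J : Finset B // Comm cs J ∧ J.card = k},
      {v : W // ∀ j ∈ J.1, ¬ cs.IsRightDescent v j}) →
      {p : W × W // IsBooleanInterval cs k p.1 p.2} :=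
    fun x => ⟨(x.2.1, x.2.1 * sP cs x.1.1), by
      have := isBoolean_sP hE hinj x.1.2.1 x.2.1 x.2.2
      rwa [x.1.2.2] at this⟩
  have hg : Function.Bijective g := by
    constructor
    · rintro ⟨⟨J, hJ, hJk⟩, ⟨v, hv⟩⟩ ⟨⟨J', hJ', hJk'⟩, ⟨v', hv'⟩⟩ h
      simp only [g, Subtype.mk.injEq, Prod.mk.injEq] at h
      obtain ⟨rfl, h⟩ := h
      rw [mul_right_inj] at h
      have := sP_inj hE hinj hJ hJ' h
      subst this
      rfl
    · rintro ⟨⟨v, w⟩, h⟩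
      obtain ⟨J, hJ, hJk, hv, hw⟩ := exists_of_isBoolean hE hinj h
      simp only at hv hw
      exact ⟨⟨⟨J, hJ, hJk⟩, ⟨v, hv⟩⟩, by simp only [g, ← hw]⟩
  rw [← Nat.card_congr (Equiv.ofBijective g hg), Nat.card_sigma, Finset.sum_mul]
  rw [Finset.sum_congr rfl (g := fun _ => Nat.card W)]
  · rw [Finset.sum_const, Finset.card_univ,
      Nat.card_eq_fintype_card (α := {J : Finset B // Comm cs J ∧ J.card = k}), smul_eq_mul]
  · rintro ⟨J, hJ, hJk⟩ _
    have := card_min hE hinj hJ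
    rw [hJk] at this
    exact this

end generic

section cosets

/-- The index of the `t`-th letter in the coset chain. -/
def sig (m t : ℕ) : ℕ := if t ≤ m then m - t else t - m

/-- The `t`-th point in the orbit of `m + 1`. -/
def pt (m t : ℕ) : ℤ := if t ≤ m then (m : ℤ) + 1 - t else (m : ℤ) - t

/-- The `t`-th coset representative. -/
def cc {W : Type*} [Group W] (S : ℕ → W) (m : ℕ) : ℕ → W
  | 0 => 1
  | t + 1 => S (sig m t) * cc S m t

/-- The parabolic subgroup generated by the first `m` generators. -/
def HH {W : Type*} [Group W] (S : ℕ → W) (m : ℕ) : Subgroup W :=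
  Subgroup.closure (S '' {p | p < m})

/-- The signed transposition, as a function on the integers. -/
def gf (p : ℕ) (x : ℤ) : ℤ :=
  if p = 0 then (if x = 1 then -1 else if x = -1 then 1 else x)
  else if x = p then p + 1 else if x = p + 1 then p
  else if x = -p then -p - 1 else if x = -p - 1 then -p else x

theorem gf_spec (p : ℕ) (x : ℤ) :
    (p = 0 ∧ x = 1 ∧ gf p x = -1) ∨ (p = 0 ∧ x = -1 ∧ gf p x = 1) ∨
    (p = 0 ∧ x ≠ 1 ∧ x ≠ -1 ∧ gf p x = x) ∨
    (p ≠ 0 ∧ x = p ∧ gf p x = p + 1) ∨ (p ≠ 0 ∧ x = p + 1 ∧ gf p x = p) ∨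
    (p ≠ 0 ∧ x = -p ∧ gf p x = -p - 1) ∨ (p ≠ 0 ∧ x = -p - 1 ∧ gf p x = -p) ∨
    (p ≠ 0 ∧ x ≠ p ∧ x ≠ p + 1 ∧ x ≠ -p ∧ x ≠ -p - 1 ∧ gf p x = x) := by
  unfold gf
  split_ifs <;> simp_all

theorem gf_invol (p : ℕ) : Function.Involutive (gf p) := by
  intro x
  have h1 := gf_spec p x
  have h2 := gf_spec p (gf p x)
  omega

theorem gf_out (p : ℕ) (x : ℤ) (h1 : x ≠ p) (h2 : x ≠ p + 1) (h3 : x ≠ -p) (h4 : x ≠ -p - 1) :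
    gf p x = x := by
  have h1 := gf_spec p x
  omega

theorem gf_supp (p : ℕ) (x : ℤ) (h : gf p x ≠ x) :
    (x = p ∨ x = p + 1 ∨ x = -p ∨ x = -p - 1) ∧ x ≠ 0 ∧ gf p x ≠ 0 ∧
    (gf p x = p ∨ gf p x = p + 1 ∨ gf p x = -p ∨ gf p x = -p - 1) := by
  have h1 := gf_spec p x
  omega

/-- The signed transposition, as a permutation of the integers. -/
def gp (p : ℕ) : Equiv.Perm ℤ := (gf_invol p).toPerm

theorem gp_apply (p : ℕ) (x : ℤ) : gp p x = gf p x := rfl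

theorem gp_sq (p : ℕ) : gp p * gp p = 1 := by
  ext x; simp [gp_apply, gf_invol p x]

theorem gf_neg (p : ℕ) (x : ℤ) : gf p (-x) = - gf p x := by
  unfold gf
  split_ifs <;> omega

theorem gp_comm (p q : ℕ) (h : p + 2 ≤ q) : gp p * gp q = gp q * gp p := by
  ext x
  simp only [Equiv.Perm.mul_apply, gp_apply]
  by_cases h1 : gf p x = x
  · by_cases h2 : gf q x = x
    · rw [h2, h1, h2]
    · have := gf_supp q x h2
      rw [h1, gf_out p (gf q x) (by omega) (by omega) (by omega) (by omega)]
  · have := gf_supp p x h1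
    rw [gf_out q x (by omega) (by omega) (by omega) (by omega),
      gf_out q (gf p x) (by omega) (by omega) (by omega) (by omega)]

theorem gp_braid (p : ℕ) (h : 1 ≤ p) :
    gp p * gp (p + 1) * gp p = gp (p + 1) * gp p * gp (p + 1) := by
  ext x
  simp only [Equiv.Perm.mul_apply, gp_apply]
  have aux : ∀ x : ℤ, gf p x = (if x = p then (p : ℤ) + 1 else if x = p + 1 then (p : ℤ)
      else if x = -p then -p - 1 else if x = -p - 1 then -p else x) := by
    intro x; unfold gf; rw [if_neg (by omega)]
  have aux' : ∀ x : ℤ, gf (p + 1) x = (if x = p + 1 then (p : ℤ) + 2 else if x = p + 2 then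
      (p : ℤ) + 1 else if x = -p - 1 then -p - 2 else if x = -p - 2 then -p - 1 else x) := by
    intro x; unfold gf; rw [if_neg (by omega)]; push_cast; split_ifs <;> omega
  have o1 : ∀ y : ℤ, y ≠ p → y ≠ p + 1 → y ≠ -p → y ≠ -p - 1 → gf p y = y := by
    intro y _ _ _ _; rw [aux]; simp [*]
  have o2 : ∀ y : ℤ, y ≠ p + 1 → y ≠ p + 2 → y ≠ -p - 1 → y ≠ -p - 2 → gf (p + 1) y = y := by
    intro y _ _ _ _; rw [aux']; simp [*]
  have a1 : gf p p = p + 1 := by rw [aux]; split_ifs <;> omega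
  have a2 : gf p (p + 1) = p := by rw [aux]; split_ifs <;> omega
  have a3 : gf p (-p) = -p - 1 := by rw [aux]; split_ifs <;> omega
  have a4 : gf p (-p - 1) = -p := by rw [aux]; split_ifs <;> omega
  have b1 : gf (p + 1) (p + 1) = p + 2 := by rw [aux']; split_ifs <;> omega
  have b2 : gf (p + 1) (p + 2) = p + 1 := by rw [aux']; split_ifs <;> omega
  have b3 : gf (p + 1) (-p - 1) = -p - 2 := by rw [aux']; split_ifs <;> omega
  have b4 : gf (p + 1) (-p - 2) = -p - 1 := by rw [aux']; split_ifs <;> omega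
  have c1 : gf p (p + 2) = p + 2 := o1 _ (by omega) (by omega) (by omega) (by omega)
  have c2 : gf p (-p - 2) = -p - 2 := o1 _ (by omega) (by omega) (by omega) (by omega)
  have c3 : gf (p + 1) p = p := o2 _ (by omega) (by omega) (by omega) (by omega)
  have c4 : gf (p + 1) (-p) = -p := o2 _ (by omega) (by omega) (by omega) (by omega)
  by_cases h1 : x = p
  · rw [h1, a1, b1, c1, c3, a1, b1]
  by_cases h2 : x = p + 1
  · rw [h2, a2, c3, a1, b1, c1, b2]
  by_cases h3 : x = p + 2
  · rw [h3, c1, b2, a2, c3]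
  by_cases h4 : x = -p
  · rw [h4, a3, b3, c2, c4, a3, b3]
  by_cases h5 : x = -p - 1
  · rw [h5, a4, c4, a3, b3, c2, b4]
  by_cases h6 : x = -p - 2
  · rw [h6, c2, b4, a4, c4]
  have d1 : gf p x = x := o1 _ h1 h2 h4 h5
  have d2 : gf (p + 1) x = x := o2 _ h2 h3 h5 h6
  simp only [d1, d2]

theorem gp_four : gp 0 * gp 1 * gp 0 * gp 1 = gp 1 * gp 0 * gp 1 * gp 0 := by
  ext x
  simp only [Equiv.Perm.mul_apply, gp_apply]
  by_cases h1 : x = 1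
  · subst h1; simp [gf]
  by_cases h2 : x = 2
  · subst h2; simp [gf]
  by_cases h3 : x = -1
  · subst h3; simp [gf]
  by_cases h4 : x = -2
  · subst h4; simp [gf]
  have d1 : gf 0 x = x := by unfold gf; split_ifs <;> omega
  have d2 : gf 1 x = x := by unfold gf; split_ifs <;> omega
  simp only [d1, d2]

theorem gf_pt (m t : ℕ) : gf (sig m t) (pt m t) = pt m (t + 1) := by
  unfold gf sig pt
  push_cast
  split_ifs <;> omega

/-- The data of generators satisfying the relations of type `B`, plus the signed
permutation representation. -/
structure Dat {W : Type*} [Group W] (n : ℕ) (S : ℕ → W) (φ : W →* Equiv.Perm ℤ) : Prop where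
  sq : ∀ p, S p * S p = 1
  comm : ∀ p q, p + 2 ≤ q → S p * S q = S q * S p
  braid : ∀ p, 1 ≤ p → p + 1 < n → S p * S (p + 1) * S p = S (p + 1) * S p * S (p + 1)
  four : S 0 * S 1 * S 0 * S 1 = S 1 * S 0 * S 1 * S 0
  map : ∀ p, p < n → φ (S p) = gp p

variable {W : Type*} [Group W] {n : ℕ} {S : ℕ → W} {φ : W →* Equiv.Perm ℤ}

theorem Dat.comm' (D : Dat n S φ) (p q : ℕ) (h1 : p ≠ q) (h2 : p ≠ q + 1) (h3 : q ≠ p + 1) :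
    S p * S q = S q * S p := by
  rcases lt_or_gt_of_ne h1 with h | h
  · exact D.comm p q (by omega)
  · exact (D.comm q p (by omega)).symm

theorem Dat.braid' (D : Dat n S φ) (p q : ℕ) (hp : 1 ≤ p) (hq : 1 ≤ q) (hpn : p < n) (hqn : q < n)
    (h : p = q + 1 ∨ q = p + 1) : S p * S q * S p = S q * S p * S q := by
  rcases h with rfl | rfl
  · exact (D.braid q hq hpn).symm
  · exact D.braid p hp hqn

theorem Dat.fix (D : Dat n S φ) {m : ℕ} (hm : m < n) (t : ℕ) :
    ∀ p, p ≤ m → p ≠ sig m t → (1 ≤ t → p ≠ sig m (t - 1)) → t ≤ 2 * m + 1 →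
    ∃ q, q < m ∧ S p * cc S m t = cc S m t * S q := by
  induction t using Nat.strong_induction_on with
  | _ t ih =>
  match t with
  | 0 =>
    intro p hp h1 _ _
    exact ⟨p, by simp [sig] at h1; omega, by simp [cc]⟩
  | t + 1 =>
    intro p hp h1 h2 ht
    have h2 : p ≠ sig m t := h2 (by omega)
    by_cases hadj : p = sig m t + 1 ∨ sig m t = p + 1
    · match t with
      | 0 => unfold sig at *; split_ifs at * <;> omega
      | t + 1 =>
        have hpt : p = sig m t := by
          unfold sig at *; split_ifs at * <;> omega
        by_cases hp0 : p = 0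
        · have htm : t = m := by unfold sig at *; split_ifs at * <;> omega
          subst htm
          match t with
          | 0 => omega
          | t + 1 =>
            have e1 : sig (t + 1) (t + 2) = 1 := by unfold sig; split_ifs <;> omega
            have e2 : sig (t + 1) (t + 1) = 0 := by unfold sig; split_ifs <;> omega
            have e3 : sig (t + 1) t = 1 := by unfold sig; split_ifs <;> omega
            obtain ⟨q, hq, e⟩ := ih t (by omega) 0 (by omega) (by omega) (by
              intro _; unfold sig; split_ifs <;> omega) (by omega)
            refine ⟨q, hq, ?_⟩
            subst hp0
            have ec : cc S (t + 1) (t + 1 + 1 + 1) = S 1 * (S 0 * (S 1 * cc S (t + 1) t)) := by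
              simp only [cc]
              rw [e1, e2, e3]
            rw [ec]
            calc S 0 * (S 1 * (S 0 * (S 1 * cc S (t + 1) t)))
                = (S 0 * S 1 * S 0 * S 1) * cc S (t + 1) t := by group
              _ = S 1 * S 0 * S 1 * (S 0 * cc S (t + 1) t) := by rw [D.four]; group
              _ = _ := by rw [e]; group
        · obtain ⟨q, hq, e⟩ := ih t (by omega) (sig m (t + 1))
            (by unfold sig at *; split_ifs at * <;> omega)
            (by omega) (by intro _; unfold sig at *; split_ifs at * <;> omega) (by omega)
          refine ⟨q, hq, ?_⟩
          simp only [cc]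
          rw [← hpt]
          have hb := D.braid' p (sig m (t + 1)) (by omega)
            (by unfold sig at *; split_ifs at * <;> omega) (by omega)
            (by unfold sig at *; split_ifs at * <;> omega) hadj
          calc S p * (S (sig m (t + 1)) * (S p * cc S m t))
              = (S p * S (sig m (t + 1)) * S p) * cc S m t := by group
            _ = S (sig m (t + 1)) * S p * (S (sig m (t + 1)) * cc S m t) := by rw [hb]; group
            _ = _ := by rw [e]; group
    · push Not at hadj
      obtain ⟨q, hq, e⟩ := ih t (by omega) p hp h2
        (by intro _; unfold sig at *; split_ifs at * <;> omega) (by omega)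
      refine ⟨q, hq, ?_⟩
      simp only [cc]
      rw [← mul_assoc, D.comm' p _ h2 hadj.1 hadj.2, mul_assoc, e, mul_assoc]

theorem Dat.inv (D : Dat n S φ) (p : ℕ) : (S p)⁻¹ = S p := inv_eq_of_mul_eq_one_right (D.sq p)

theorem mem_HH {m p : ℕ} (h : p < m) : S p ∈ HH S m := Subgroup.subset_closure ⟨p, h, rfl⟩

theorem Dat.decomp (D : Dat n S φ) {m : ℕ} (hm : m < n) {w : W} (hw : w ∈ HH S (m + 1)) :
    ∃ t, t ≤ 2 * m + 1 ∧ ∃ h ∈ HH S m, w = cc S m t * h := by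
  have step : ∀ p, p ≤ m → ∀ y : W, (∃ t, t ≤ 2 * m + 1 ∧ ∃ h ∈ HH S m, y = cc S m t * h) →
      ∃ t, t ≤ 2 * m + 1 ∧ ∃ h ∈ HH S m, S p * y = cc S m t * h := by
    rintro p hp _ ⟨t, ht, h, hh, rfl⟩
    by_cases h1 : p = sig m t
    · refine ⟨t + 1, ?_, h, hh, ?_⟩
      · unfold sig at *; split_ifs at * <;> omega
      · rw [h1]; simp only [cc]; group
    · by_cases h2 : 1 ≤ t → p ≠ sig m (t - 1)
      · obtain ⟨q, hq, e⟩ := D.fix hm t p hp h1 h2 ht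
        refine ⟨t, ht, S q * h, mul_mem (mem_HH hq) hh, ?_⟩
        rw [← mul_assoc, e, mul_assoc]
      · push Not at h2
        obtain ⟨h2, h3⟩ := h2
        obtain ⟨t, rfl⟩ : ∃ u, t = u + 1 := ⟨t - 1, by omega⟩
        refine ⟨t, by omega, h, hh, ?_⟩
        simp only [Nat.add_sub_cancel] at h3
        simp only [cc]
        rw [h3, ← mul_assoc, ← mul_assoc, D.sq, one_mul]
  unfold HH at hw
  induction hw using Subgroup.closure_induction_left with
  | one => exact ⟨0, by omega, 1, one_mem _, by simp [cc]⟩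
  | mul_left x hx y hy ih =>
    obtain ⟨p, hp, rfl⟩ := hx
    exact step p (Nat.lt_succ_iff.1 hp) y ih
  | inv_mul_cancel x hx y hy ih =>
    obtain ⟨p, hp, rfl⟩ := hx
    rw [D.inv]
    exact step p (Nat.lt_succ_iff.1 hp) y ih

theorem Dat.cc_mem {m : ℕ} {t : ℕ} (ht : t ≤ 2 * m + 1) : cc S m t ∈ HH S (m + 1) := by
  induction t with
  | zero => exact one_mem _
  | succ t ih =>
    exact mul_mem (mem_HH (by unfold sig; split_ifs <;> omega)) (ih (by omega))

theorem HH_mono {m : ℕ} : HH S m ≤ HH S (m + 1) :=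
  Subgroup.closure_mono (Set.image_mono (fun p (hp : p < m) => show p < m + 1 by omega))

theorem Dat.cc_pt (D : Dat n S φ) {m : ℕ} (hm : m < n) {t : ℕ} (ht : t ≤ 2 * m + 1) :
    φ (cc S m t) (m + 1) = pt m t := by
  induction t with
  | zero => simp [cc, pt]
  | succ t ih =>
    simp only [cc, map_mul, Equiv.Perm.mul_apply]
    rw [ih (by omega), D.map _ (by unfold sig; split_ifs <;> omega), gp_apply, gf_pt]

theorem Dat.HH_fix (D : Dat n S φ) {m : ℕ} (hm : m < n) {w : W} (hw : w ∈ HH S m) :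
    φ w (m + 1) = m + 1 := by
  have key : ∀ p, p < m → φ (S p) (m + 1) = m + 1 := by
    intro p hp
    rw [D.map p (by omega), gp_apply]
    unfold gf; split_ifs <;> omega
  unfold HH at hw
  induction hw using Subgroup.closure_induction_left with
  | one => simp
  | mul_left x hx y hy ih =>
    obtain ⟨p, hp, rfl⟩ := hx
    rw [map_mul, Equiv.Perm.mul_apply, ih, key p hp]
  | inv_mul_cancel x hx y hy ih =>
    obtain ⟨p, hp, rfl⟩ := hx
    rw [D.inv, map_mul, Equiv.Perm.mul_apply, ih, key p hp]

theorem pt_inj {m t t' : ℕ} (_ht : t ≤ 2 * m + 1) (_ht2 : t' ≤ 2 * m + 1) (h : pt m t = pt m t') :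
    t = t' := by
  unfold pt at h; split_ifs at h <;> omega

theorem HH_zero : HH S 0 = ⊥ := by simp [HH]

theorem Dat.card_HH (D : Dat n S φ) (m : ℕ) (hm : m ≤ n) :
    Nat.card (HH S m) = 2 ^ m * m.factorial := by
  induction m with
  | zero => rw [HH_zero]; simp
  | succ m ih =>
    have hm' : m < n := by omega
    let g : Fin (2 * m + 2) × HH S m → HH S (m + 1) := fun x =>
      ⟨cc S m x.1 * x.2.1, mul_mem (Dat.cc_mem (by omega)) (HH_mono x.2.2)⟩
    have hg : Function.Bijective g := by
      constructor
      · rintro ⟨⟨t, ht⟩, ⟨h, hh⟩⟩ ⟨⟨t', ht'⟩, ⟨h', hh'⟩⟩ e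
        simp only [g, Subtype.mk.injEq] at e
        have e2 := congrArg (fun w => φ w (m + 1)) e
        simp only [map_mul, Equiv.Perm.mul_apply] at e2
        rw [D.HH_fix hm' hh, D.HH_fix hm' hh', D.cc_pt hm' (by omega),
          D.cc_pt hm' (by omega)] at e2
        have := pt_inj (by omega) (by omega) e2
        subst this
        rw [mul_right_inj] at e
        subst e
        rfl
      · rintro ⟨w, hw⟩
        obtain ⟨t, ht, h, hh, rfl⟩ := D.decomp hm' hw
        exact ⟨⟨⟨t, by omega⟩, ⟨h, hh⟩⟩, rfl⟩
    rw [← Nat.card_congr (Equiv.ofBijective g hg), Nat.card_prod, ih (by omega), Nat.card_fin,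
      Nat.factorial_succ]
    ring

theorem Dat.inj_HH (D : Dat n S φ) (m : ℕ) (hm : m ≤ n) :
    ∀ w ∈ HH S m, φ w = 1 → w = 1 := by
  induction m with
  | zero => intro w hw _; rw [HH_zero] at hw; exact hw
  | succ m ih =>
    intro w hw h1
    obtain ⟨t, ht, h, hh, rfl⟩ := D.decomp (by omega) hw
    have e := congrArg (fun g : Equiv.Perm ℤ => g (m + 1)) h1
    simp only [map_mul, Equiv.Perm.mul_apply, Equiv.Perm.one_apply] at e
    rw [D.HH_fix (by omega) hh, D.cc_pt (by omega) ht] at e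
    have : t = 0 := pt_inj ht (by omega) (by rw [e]; simp [pt])
    subst this
    simp only [cc, one_mul] at h1 ⊢
    exact ih (by omega) h hh h1

end cosets

section final

theorem comm_iff_pow {G : Type*} [Group G] (a b : G) (ha : a * a = 1) (hb : b * b = 1) :
    (a * b) ^ 2 = 1 ↔ a * b = b * a := by
  have ha' : a⁻¹ = a := inv_eq_of_mul_eq_one_left ha
  have hb' : b⁻¹ = b := inv_eq_of_mul_eq_one_left hb
  have e : (a * b) ^ 2 = (a * b) * (b * a)⁻¹ := by
    rw [mul_inv_rev, ha', hb', pow_two]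
  rw [e, mul_inv_eq_one]

theorem braid_iff_pow {G : Type*} [Group G] (a b : G) (ha : a * a = 1) (hb : b * b = 1) :
    (a * b) ^ 3 = 1 ↔ a * b * a = b * a * b := by
  have ha' : a⁻¹ = a := inv_eq_of_mul_eq_one_left ha
  have hb' : b⁻¹ = b := inv_eq_of_mul_eq_one_left hb
  have e : (a * b) ^ 3 = (a * b * a) * (b * a * b)⁻¹ := by
    simp only [mul_inv_rev, ha', hb', pow_succ, pow_zero, one_mul, mul_assoc]
  rw [e, mul_inv_eq_one]

theorem four_iff_pow {G : Type*} [Group G] (a b : G) (ha : a * a = 1) (hb : b * b = 1) :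
    (a * b) ^ 4 = 1 ↔ a * b * a * b = b * a * b * a := by
  have ha' : a⁻¹ = a := inv_eq_of_mul_eq_one_left ha
  have hb' : b⁻¹ = b := inv_eq_of_mul_eq_one_left hb
  have e : (a * b) ^ 4 = (a * b * a * b) * (b * a * b * a)⁻¹ := by
    simp only [mul_inv_rev, ha', hb', pow_succ, pow_zero, one_mul, mul_assoc]
  rw [e, mul_inv_eq_one]

theorem B_entry (n : ℕ) (i j : Fin n) : CoxeterMatrix.B n i j =
    if i = j then 1
      else (if (i : ℕ) = n - 1 ∧ (j : ℕ) = n - 2 ∨ (j : ℕ) = n - 1 ∧ (i : ℕ) = n - 2 then 4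
        else (if (j : ℕ) + 1 = i ∨ (i : ℕ) + 1 = j then 3 else 2)) := rfl

theorem liftable (n : ℕ) :
    (CoxeterMatrix.B n).IsLiftable (fun i : Fin n => gp (n - 1 - (i : ℕ))) := by
  intro i j
  have hi := i.2
  have hj := j.2
  rw [B_entry]
  simp only
  split_ifs with h1 h2 h3
  · rw [h1, pow_one, gp_sq]
  · rw [four_iff_pow _ _ (gp_sq _) (gp_sq _)]
    have h1' : (i : ℕ) ≠ j := fun h => h1 (Fin.ext h)
    rcases h2 with ⟨h, h'⟩ | ⟨h, h'⟩
    · have e1 : n - 1 - (i : ℕ) = 0 := by omega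
      have e2 : n - 1 - (j : ℕ) = 1 := by omega
      rw [e1, e2, gp_four]
    · have e1 : n - 1 - (i : ℕ) = 1 := by omega
      have e2 : n - 1 - (j : ℕ) = 0 := by omega
      rw [e1, e2, gp_four]
  · rw [braid_iff_pow _ _ (gp_sq _) (gp_sq _)]
    rcases h3 with h | h
    · have e2 : n - 1 - (j : ℕ) = n - 1 - (i : ℕ) + 1 := by omega
      rw [e2, gp_braid _ (by omega)]
    · have e2 : n - 1 - (i : ℕ) = n - 1 - (j : ℕ) + 1 := by omega
      rw [e2, gp_braid _ (by omega)]
  · rw [comm_iff_pow _ _ (gp_sq _) (gp_sq _)]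
    have h1' : (i : ℕ) ≠ j := fun h => h1 (Fin.ext h)
    rcases lt_or_gt_of_ne h1' with h | h
    · rw [gp_comm (n - 1 - (j : ℕ)) (n - 1 - (i : ℕ)) (by omega)]
    · rw [gp_comm (n - 1 - (i : ℕ)) (n - 1 - (j : ℕ)) (by omega)]

variable {W : Type*} [Group W] {n : ℕ} (cs : CoxeterSystem (CoxeterMatrix.B n) W)

/-- The signed permutation representation. -/
noncomputable def rep : W →* Equiv.Perm ℤ := cs.lift ⟨_, liftable n⟩

theorem rep_simple (i : Fin n) : rep cs (cs.simple i) = gp (n - 1 - (i : ℕ)) :=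
  cs.lift_apply_simple (liftable n) i

/-- The generators, indexed by position. -/
noncomputable def SS (p : ℕ) : W :=
  if h : p < n then cs.simple ⟨n - 1 - p, by omega⟩ else 1

theorem SS_sq (p : ℕ) : SS cs p * SS cs p = 1 := by
  unfold SS
  split_ifs <;> simp

theorem simple_eq_SS (i : Fin n) : cs.simple i = SS cs (n - 1 - (i : ℕ)) := by
  have hi := i.2
  unfold SS
  rw [dif_pos (by omega)]
  congr 1
  ext
  simp only
  omega

theorem SS_comm (p q : ℕ) (h : p + 2 ≤ q) : SS cs p * SS cs q = SS cs q * SS cs p := by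
  by_cases hq : q < n
  · rw [← comm_iff_pow _ _ (SS_sq cs _) (SS_sq cs _)]
    unfold SS
    rw [dif_pos hq, dif_pos (by omega)]
    have := cs.simple_mul_simple_pow ⟨n - 1 - p, by omega⟩ ⟨n - 1 - q, by omega⟩
    rw [B_entry, if_neg (by simp only [Fin.mk.injEq]; omega), if_neg (by simp only; omega),
      if_neg (by simp only; omega)] at this
    exact this
  · have : SS cs q = 1 := by unfold SS; rw [dif_neg hq]
    rw [this, one_mul, mul_one]

theorem dat (hn : 2 ≤ n) : Dat n (SS cs) (rep cs) where
  sq := SS_sq cs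
  comm := SS_comm cs
  braid := by
    intro p h1 h2
    rw [← braid_iff_pow _ _ (SS_sq cs _) (SS_sq cs _)]
    unfold SS
    rw [dif_pos h2, dif_pos (by omega)]
    have := cs.simple_mul_simple_pow ⟨n - 1 - p, by omega⟩ ⟨n - 1 - (p + 1), by omega⟩
    rw [B_entry, if_neg (by simp only [Fin.mk.injEq]; omega), if_neg (by simp only; omega),
      if_pos (by simp only; omega)] at this
    exact this
  four := by
    rw [← four_iff_pow _ _ (SS_sq cs _) (SS_sq cs _)]
    unfold SS
    rw [dif_pos (by omega), dif_pos (by omega)]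
    have := cs.simple_mul_simple_pow ⟨n - 1 - 0, by omega⟩ ⟨n - 1 - 1, by omega⟩
    rw [B_entry, if_neg (by simp only [Fin.mk.injEq]; omega), if_pos (by simp only; omega)] at this
    exact this
  map := by
    intro p hp
    unfold SS
    rw [dif_pos hp, rep_simple]
    congr 1
    simp only
    omega

theorem HH_top : HH (SS cs) n = ⊤ := by
  rw [eq_top_iff, ← cs.subgroup_closure_range_simple, Subgroup.closure_le]
  rintro _ ⟨i, rfl⟩
  rw [simple_eq_SS]
  have hi := i.2
  exact Subgroup.subset_closure ⟨_, by simp only [Set.mem_ofPred_eq]; omega, rfl⟩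

theorem card_W {W : Type*} [Group W] {n : ℕ} (cs : CoxeterSystem (CoxeterMatrix.B n) W) (hn : 2 ≤ n) : Nat.card W = 2 ^ n * n.factorial := by
  rw [← (dat cs hn).card_HH n le_rfl, HH_top, Subgroup.card_top]

theorem rep_inj (hn : 2 ≤ n) : Function.Injective (rep cs) := by
  rw [injective_iff_map_eq_one]
  intro w hw
  exact (dat cs hn).inj_HH n le_rfl w (by rw [HH_top]; trivial) hw

theorem rep_neg (w : W) : ∀ x : ℤ, rep cs w (-x) = - rep cs w x := by
  induction w using cs.simple_induction_left with
  | one => intro x; simp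
  | mul_simple_left w i ih =>
    intro x
    rw [map_mul, Equiv.Perm.mul_apply, Equiv.Perm.mul_apply, ih, rep_simple, gp_apply, gp_apply,
      gf_neg]

/-- First element of the pair at a position. -/
def fst' (p : ℕ) : ℤ := if p = 0 then -1 else p

/-- Second element of the pair at a position. -/
def snd' (p : ℕ) : ℤ := if p = 0 then 1 else p + 1

theorem gf_fst (p : ℕ) : gf p (fst' p) = snd' p := by
  have h := gf_spec p (fst' p)
  have h1 : p = 0 ∧ fst' p = -1 ∧ snd' p = 1 ∨ p ≠ 0 ∧ fst' p = p ∧ snd' p = p + 1 := by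
    unfold fst' snd'
    split_ifs <;> simp_all
  omega

theorem gf_snd (p : ℕ) : gf p (snd' p) = fst' p := by
  have h := gf_spec p (snd' p)
  have h1 : p = 0 ∧ fst' p = -1 ∧ snd' p = 1 ∨ p ≠ 0 ∧ fst' p = p ∧ snd' p = p + 1 := by
    unfold fst' snd'
    split_ifs <;> simp_all
  omega

theorem gf_mid (q : ℕ) (x y : ℤ) (hx : x ≠ 0) (hy : y ≠ 0) (hxy : x < y)
    (h : gf q y < gf q x) : gf q x = y ∧ gf q y = x := by
  have h1 := gf_spec q x
  have h2 := gf_spec q y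
  omega

theorem conj_key (σ : Equiv.Perm ℤ) (hσ : ∀ x, σ (-x) = - σ x) (p q : ℕ)
    (h1 : σ (fst' p) < σ (snd' p)) (h2 : gf q (σ (snd' p)) < gf q (σ (fst' p))) :
    gp q * σ = σ * gp p := by
  have h0 : σ 0 = 0 := by
    have := hσ 0
    simp only [neg_zero] at this
    omega
  have hf : fst' p ≠ 0 := by unfold fst'; split_ifs <;> omega
  have hx : σ (fst' p) ≠ 0 := by
    rw [← h0]; exact fun h => hf (σ.injective h)
  have hs : snd' p ≠ 0 := by unfold snd'; split_ifs <;> omega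
  have hy : σ (snd' p) ≠ 0 := by
    rw [← h0]; exact fun h => hs (σ.injective h)
  obtain ⟨k1, k2⟩ := gf_mid q _ _ hx hy h1 h2
  ext z
  rw [Equiv.Perm.mul_apply, Equiv.Perm.mul_apply, gp_apply, gp_apply]
  by_cases c1 : z = fst' p
  · rw [c1, gf_fst, k1]
  by_cases c2 : z = snd' p
  · rw [c2, gf_snd, k2]
  by_cases c3 : z = - fst' p
  · rw [c3, gf_neg, hσ, hσ, gf_neg, gf_fst, k1]
  by_cases c4 : z = - snd' p
  · rw [c4, gf_neg, hσ, hσ, gf_neg, gf_snd, k2]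
  have d1 : gf p z = z := by
    have := gf_spec p z
    unfold fst' snd' at *
    split_ifs at * <;> omega
  rw [d1]
  have e1 : σ z ≠ σ (fst' p) := fun h => c1 (σ.injective h)
  have e2 : σ z ≠ σ (snd' p) := fun h => c2 (σ.injective h)
  have e3 : σ z ≠ - σ (fst' p) := fun h => c3 (σ.injective (by rw [h, hσ]))
  have e4 : σ z ≠ - σ (snd' p) := fun h => c4 (σ.injective (by rw [h, hσ]))
  have g1 := gf_spec q (σ z)
  have g2 := gf_spec q (σ (fst' p))
  omega

theorem lemA (hn : 2 ≤ n) (i : Fin n) (ω : List (Fin n))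
    (h : rep cs (cs.wordProd ω) (snd' (n - 1 - i)) < rep cs (cs.wordProd ω) (fst' (n - 1 - i))) :
    ∃ j, j < ω.length ∧ cs.wordProd ω * cs.simple i = cs.wordProd (ω.eraseIdx j) := by
  induction ω with
  | nil =>
    exfalso
    simp only [wordProd_nil, map_one, Equiv.Perm.one_apply] at h
    unfold fst' snd' at h
    split_ifs at h <;> omega
  | cons a ω ih =>
    by_cases hd : rep cs (cs.wordProd ω) (snd' (n - 1 - i)) <
        rep cs (cs.wordProd ω) (fst' (n - 1 - i))
    · obtain ⟨j, hj, e⟩ := ih hd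
      refine ⟨j + 1, by simpa using hj, ?_⟩
      rw [List.eraseIdx_cons_succ, wordProd_cons, wordProd_cons, mul_assoc, e]
    · refine ⟨0, by simp, ?_⟩
      rw [List.eraseIdx_cons_zero, wordProd_cons]
      have hne : rep cs (cs.wordProd ω) (snd' (n - 1 - i)) ≠
          rep cs (cs.wordProd ω) (fst' (n - 1 - i)) := by
        intro hh
        have := (rep cs (cs.wordProd ω)).injective hh
        unfold fst' snd' at this
        split_ifs at this <;> omega
      have hlt := lt_of_le_of_ne (not_lt.mp hd) hne.symm
      rw [wordProd_cons, map_mul, Equiv.Perm.mul_apply, Equiv.Perm.mul_apply, rep_simple,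
        gp_apply, gp_apply] at h
      have key := conj_key (rep cs (cs.wordProd ω)) (rep_neg cs _) (n - 1 - i) (n - 1 - a) hlt h
      have : cs.simple a * cs.wordProd ω = cs.wordProd ω * cs.simple i := by
        apply rep_inj cs hn
        rw [map_mul, map_mul, rep_simple, rep_simple, key]
      rw [this, simple_mul_simple_cancel_right]

theorem exch (hn : 2 ≤ n) : Exch cs := by
  intro ω i hdes
  apply lemA cs hn
  by_contra hd
  set w := cs.wordProd ω with hw
  have hne : rep cs w (snd' (n - 1 - i)) ≠ rep cs w (fst' (n - 1 - i)) := by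
    intro hh
    have := (rep cs w).injective hh
    unfold fst' snd' at this
    split_ifs at this <;> omega
  have hlt := lt_of_le_of_ne (not_lt.mp hd) hne.symm
  obtain ⟨τ, hτ, e⟩ := cs.exists_isReduced (w * cs.simple i)
  obtain ⟨j, hj, e2⟩ := lemA cs hn i τ (by
    rw [← e, map_mul, Equiv.Perm.mul_apply, Equiv.Perm.mul_apply, rep_simple, gp_apply, gp_apply,
      gf_fst, gf_snd]
    exact hlt)
  rw [← e, simple_mul_simple_cancel_right] at e2
  have l1 : cs.length w ≤ (τ.eraseIdx j).length := by
    rw [e2]; exact cs.length_wordProd_le _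
  have l2 : cs.length (w * cs.simple i) = τ.length := by rw [e]; exact hτ
  have l3 := List.length_eraseIdx_add_one hj
  unfold IsRightDescent at hdes
  omega

theorem gp_inj (p q : ℕ) (h : gp p = gp q) : p = q := by
  have h1 := congrArg (fun f : Equiv.Perm ℤ => f (p + 1)) h
  have h2 := congrArg (fun f : Equiv.Perm ℤ => f (q + 1)) h
  simp only [gp_apply] at h1 h2
  have a1 := gf_spec p (p + 1)
  have a2 := gf_spec q (p + 1)
  have a3 := gf_spec p (q + 1)
  have a4 := gf_spec q (q + 1)
  omega

theorem simple_inj : Function.Injective cs.simple := by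
  intro i j h
  have := congrArg (rep cs) h
  rw [rep_simple, rep_simple] at this
  have := gp_inj _ _ this
  have hi := i.2
  have hj := j.2
  ext
  omega

theorem gp_not_comm (p : ℕ) : gp p * gp (p + 1) ≠ gp (p + 1) * gp p := by
  intro h
  have h1 := congrArg (fun f : Equiv.Perm ℤ => f (p + 2)) h
  simp only [Equiv.Perm.mul_apply, gp_apply] at h1
  have a1 : gf (p + 1) (p + 2) = p + 1 := by unfold gf; push_cast; split_ifs <;> omega
  have a2 : gf p (p + 2) = p + 2 := by unfold gf; split_ifs <;> omega
  rw [a1, a2, a1] at h1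
  have := gf_spec p (p + 1)
  omega

theorem comm_iff (i j : Fin n) : cs.simple i * cs.simple j = cs.simple j * cs.simple i ↔
    (i : ℕ) + 1 ≠ j ∧ (j : ℕ) + 1 ≠ i := by
  have hi := i.2
  have hj := j.2
  constructor
  · intro h
    have := congrArg (rep cs) h
    rw [map_mul, map_mul, rep_simple, rep_simple] at this
    constructor
    · intro e
      have e2 : n - 1 - (i : ℕ) = n - 1 - (j : ℕ) + 1 := by omega
      rw [e2] at this
      exact gp_not_comm _ this.symm
    · intro e
      have e2 : n - 1 - (j : ℕ) = n - 1 - (i : ℕ) + 1 := by omega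
      rw [e2] at this
      exact gp_not_comm _ this
  · rintro ⟨h1, h2⟩
    rcases lt_trichotomy (i : ℕ) j with h | h | h
    · rw [simple_eq_SS, simple_eq_SS, SS_comm cs (n - 1 - (j : ℕ)) (n - 1 - (i : ℕ)) (by omega)]
    · rw [Fin.ext h]
    · rw [simple_eq_SS, simple_eq_SS, SS_comm cs (n - 1 - (i : ℕ)) (n - 1 - (j : ℕ)) (by omega)]

/-- Sets of `k` pairwise nonadjacent vertices in the path on `n` vertices. -/
def indep (n k : ℕ) : Finset (Finset ℕ) :=
  ((Finset.range n).powersetCard k).filter (fun J => ∀ x ∈ J, x + 1 ∉ J)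

theorem indep_zero (n : ℕ) : (indep n 0).card = 1 := by
  simp [indep, Finset.filter_singleton]

theorem indep_rec (n k : ℕ) :
    (indep (n + 2) (k + 1)).card = (indep (n + 1) (k + 1)).card + (indep n k).card := by
  have e : indep (n + 2) (k + 1) = indep (n + 1) (k + 1) ∪ (indep n k).image (insert (n + 1)) := by
    ext J
    simp only [indep, Finset.mem_union, Finset.mem_image, Finset.mem_filter,
      Finset.mem_powersetCard]
    constructor
    · rintro ⟨⟨h1, h2⟩, h3⟩
      by_cases hm : n + 1 ∈ J
      · right
        refine ⟨J.erase (n + 1), ⟨⟨?_, ?_⟩, ?_⟩, Finset.insert_erase hm⟩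
        · intro x hx
          rw [Finset.mem_erase] at hx
          have a := Finset.mem_range.mp (h1 hx.2)
          have b : x ≠ n := by
            rintro rfl
            exact h3 _ hx.2 hm
          rw [Finset.mem_range]
          omega
        · rw [Finset.card_erase_of_mem hm, h2]; rfl
        · intro x hx hx'
          exact h3 x (Finset.mem_of_mem_erase hx) (Finset.mem_of_mem_erase hx')
      · left
        refine ⟨⟨?_, h2⟩, h3⟩
        intro x hx
        have a := Finset.mem_range.mp (h1 hx)
        have b : x ≠ n + 1 := by rintro rfl; exact hm hx
        rw [Finset.mem_range]
        omega
    · rintro (⟨⟨h1, h2⟩, h3⟩ | ⟨K, ⟨⟨h1, h2⟩, h3⟩, rfl⟩)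
      · exact ⟨⟨h1.trans (Finset.range_mono (by omega)), h2⟩, h3⟩
      · have hlt : ∀ x ∈ K, x < n := fun x hx => Finset.mem_range.mp (h1 hx)
        have hnot : n + 1 ∉ K := fun h => by have := hlt _ h; omega
        refine ⟨⟨?_, ?_⟩, ?_⟩
        · intro x hx
          rw [Finset.mem_range]
          rcases Finset.mem_insert.mp hx with rfl | hx
          · omega
          · have := hlt x hx; omega
        · rw [Finset.card_insert_of_notMem hnot, h2]
        · intro x hx hx'
          rcases Finset.mem_insert.mp hx with rfl | hx
          · rcases Finset.mem_insert.mp hx' with h | h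
            · omega
            · have := hlt _ h; omega
          · rcases Finset.mem_insert.mp hx' with h | h
            · have := hlt _ hx; omega
            · exact h3 x hx h
  rw [e, Finset.card_union_of_disjoint, Finset.card_image_of_injOn]
  · intro K hK L hL h
    have aux : ∀ K ∈ indep n k, (insert (n + 1) K).erase (n + 1) = K := by
      intro K hK
      apply Finset.erase_insert
      intro hmem
      simp only [indep, Finset.mem_filter, Finset.mem_powersetCard] at hK
      have := Finset.mem_range.mp (hK.1.1 hmem)
      omega
    rw [← aux K hK, ← aux L hL]
    rw [h]
  · rw [Finset.disjoint_left]
    intro J hJ hJ'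
    obtain ⟨K, _, rfl⟩ := Finset.mem_image.mp hJ'
    simp only [indep, Finset.mem_filter, Finset.mem_powersetCard] at hJ
    have := Finset.mem_range.mp (hJ.1.1 (Finset.mem_insert_self _ _))
    omega

theorem card_indep : ∀ n k : ℕ, (indep n k).card = Nat.choose (n + 1 - k) k
  | n, 0 => by simp [indep_zero]
  | 0, k + 1 => by
    simp [indep, Finset.powersetCard_eq_empty.mpr]
  | 1, 1 => by decide
  | 1, k + 2 => by
    have : Finset.powersetCard (k + 2) (Finset.range 1) = ∅ := by
      apply Finset.powersetCard_eq_empty.mpr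
      simp
    simp [indep, this]
  | n + 2, k + 1 => by
    rw [indep_rec, card_indep (n + 1) (k + 1), card_indep n k]
    by_cases h : k ≤ n + 1
    · have e1 : n + 2 + 1 - (k + 1) = (n + 1 - k) + 1 := by omega
      have e2 : n + 1 + 1 - (k + 1) = n + 1 - k := by omega
      rw [e1, e2, Nat.choose_succ_succ, add_comm]
    · rw [Nat.choose_eq_zero_of_lt (by omega), Nat.choose_eq_zero_of_lt (by omega),
        Nat.choose_eq_zero_of_lt (by omega)]

theorem card_comm (k : ℕ) :
    Nat.card {J : Finset (Fin n) // Comm cs J ∧ J.card = k} = Nat.choose (n + 1 - k) k := by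
  rw [← card_indep, ← Nat.card_eq_finsetCard]
  have hc : ∀ J : Finset (Fin n), Comm cs J ↔ ∀ i ∈ J, ∀ j ∈ J, (i : ℕ) + 1 ≠ j := by
    intro J
    constructor
    · intro h i hi j hj
      exact ((comm_iff cs i j).mp (h i hi j hj)).1
    · intro h i hi j hj
      exact (comm_iff cs i j).mpr ⟨h i hi j hj, h j hj i hi⟩
  have hmem : ∀ J : Finset (Fin n), (Comm cs J ∧ J.card = k) ↔
      J.map Fin.valEmbedding ∈ indep n k := by
    intro J
    rw [hc]
    simp only [indep, Finset.mem_filter, Finset.mem_powersetCard, Finset.card_map]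
    constructor
    · rintro ⟨h1, h2⟩
      refine ⟨⟨?_, h2⟩, ?_⟩
      · intro x hx
        obtain ⟨y, _, rfl⟩ := Finset.mem_map.mp hx
        exact Finset.mem_range.mpr y.2
      · intro x hx hx'
        obtain ⟨y, hy, rfl⟩ := Finset.mem_map.mp hx
        obtain ⟨z, hz, e⟩ := Finset.mem_map.mp hx'
        exact h1 y hy z hz e.symm
    · rintro ⟨⟨_, h2⟩, h3⟩
      refine ⟨?_, h2⟩
      intro i hi j hj e
      have := h3 i (Finset.mem_map.mpr ⟨i, hi, rfl⟩)
      rw [e] at this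
      exact this (Finset.mem_map.mpr ⟨j, hj, rfl⟩)
  refine Nat.card_congr (Equiv.ofBijective (fun J => ⟨J.1.map Fin.valEmbedding, (hmem J.1).mp J.2⟩)
    ⟨?_, ?_⟩)
  · intro J K h
    simp only [Subtype.mk.injEq] at h
    exact Subtype.ext (Finset.map_injective _ h)
  · rintro ⟨K, hK⟩
    have hK' := hK
    simp only [indep, Finset.mem_filter, Finset.mem_powersetCard] at hK'
    have hlt : ∀ x ∈ K, x < n := fun x hx => Finset.mem_range.mp (hK'.1.1 hx)
    have e : (K.attachFin hlt).map Fin.valEmbedding = K := Finset.map_valEmbedding_attachFin hlt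
    exact ⟨⟨K.attachFin hlt, (hmem _).mpr (by rw [e]; exact hK)⟩, Subtype.ext e⟩

end final

end BoolInt

/-- For the hyperoctahedral group `Cₙ`, i.e. the Coxeter group of type
`Cₙ = Bₙ` (`n ≥ 2`), the number of Boolean intervals of rank `k` in the right weak order
equals `2^(n-k) · n! · C(n + 1 - k, k)`. -/
theorem card_booleanIntervals_typeC {W : Type*} [Group W] (n k : ℕ) (hn : 2 ≤ n)
    (cs : CoxeterSystem (CoxeterMatrix.Bₙ n) W) :
    Nat.card {p : W × W // IsBooleanInterval cs k p.1 p.2} =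
      2 ^ (n - k) * n.factorial * Nat.choose (n + 1 - k) k := by
  have hW := BoolInt.card_W cs hn
  haveI : Finite W := Nat.finite_of_card_ne_zero (by rw [hW]; positivity)
  have h := BoolInt.card_generic (cs := cs) (BoolInt.exch cs hn) (BoolInt.simple_inj cs) k
  have hc : Nat.card {J : Finset (Fin n) // BoolInt.Comm cs J ∧ J.card = k} =
      Nat.choose (n + 1 - k) k := BoolInt.card_comm (n := n) cs k
  rw [hc, hW] at h
  by_cases hk : k ≤ n
  · have e : 2 ^ n = 2 ^ (n - k) * 2 ^ k := by rw [← pow_add, Nat.sub_add_cancel hk]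
    rw [e] at h
    apply Nat.eq_of_mul_eq_mul_right (show 0 < 2 ^ k by positivity)
    rw [h]
    ring
  · have e : Nat.choose (n + 1 - k) k = 0 := Nat.choose_eq_zero_of_lt (by omega)
    rw [e, zero_mul] at h
    rw [e, mul_zero]
    exact (Nat.mul_eq_zero.mp h).resolve_right (by positivity)
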